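/- Let n ≥ 3, 1 < p < ∞, −1 < α < ∞ and C₃ ≥ 1. Suppose 𝒟 is a family of nonempty Borel subsets of ∂𝔹_n such that for every x ∈ ∂𝔹_n and every 0 < r < 1 there exists Q ∈ 𝒟 with B_ρ(x,r) ⊆ Q and diam_ρ(Q) ≤ C₃ · diam_ρ(B_ρ(x,r)). Then there exists a constant c₅ depending only on n, p, α and C₃ such that for every weight ω on 𝔹_n, [ω]_{p,α} ≤ c₅ · sup_{Q ∈ 𝒟} |Q̂|_{ω,α} · (|Q̂|_{ω^{1−p'},α})^{p−1} / (|Q̂|_α)^p. -/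

import Mathlib

open MeasureTheory Metric
open scoped ENNReal RealInnerProductSpace

noncomputable section

abbrev Eucl (n : ℕ) : Type := EuclideanSpace ℝ (Fin n)

/-- The spherical (angular) distance `ρ(x,y) = arccos ⟨x,y⟩`. -/
def rho {n : ℕ} (x y : Eucl n) : ℝ := Real.arccos ⟪x, y⟫

/-- The (unnormalized) weighted measure `(1-|x|²)^α dν` on the unit ball. -/
def muA (n : ℕ) (α : ℝ) : Measure (Eucl n) :=
  (volume.restrict (ball (0 : Eucl n) 1)).withDensity
    fun x => ENNReal.ofReal ((1 - ‖x‖ ^ 2) ^ α)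

/-- The normalized weighted measure `ν_α` with `ν_α(𝔹_n) = 1`. -/
def nuA (n : ℕ) (α : ℝ) : Measure (Eucl n) := (muA n α Set.univ)⁻¹ • muA n α

/-- The spherical ball `B_ρ(x,r)` on the unit sphere. -/
def sBall {n : ℕ} (x : Eucl n) (r : ℝ) : Set (Eucl n) := {y | ‖y‖ = 1 ∧ rho x y < r}

/-- The Carleson box of the spherical ball `B_ρ(x,r)`. -/
def cBoxBall {n : ℕ} (x : Eucl n) (r : ℝ) : Set (Eucl n) :=
  {z | ‖z‖ < 1 ∧ 1 - r < ‖z‖ ∧ ‖z‖⁻¹ • z ∈ sBall x r}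

/-- The `ρ`-diameter of a subset of the sphere. -/
def diamRho {n : ℕ} (Q : Set (Eucl n)) : ℝ :=
  sSup {d | ∃ x ∈ Q, ∃ y ∈ Q, d = rho x y}

/-- The Carleson box of a subset `Q` of the sphere. -/
def cBox {n : ℕ} (Q : Set (Eucl n)) : Set (Eucl n) :=
  {z | ‖z‖ < 1 ∧ 1 - diamRho Q / 2 < ‖z‖ ∧ ‖z‖⁻¹ • z ∈ Q}

/-- The `ε`-Carleson box of a subset `Q` of the sphere. -/
def cBoxEps {n : ℕ} (ε : ℝ) (Q : Set (Eucl n)) : Set (Eucl n) :=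
  {z | ‖z‖ < 1 ∧ 1 - ε * diamRho Q / 2 < ‖z‖ ∧ ‖z‖⁻¹ • z ∈ Q}

/-- `|S|_{ω,α} = ∫_S ω dν_α`. -/
def wInt {n : ℕ} (α : ℝ) (ω : Eucl n → ℝ) (S : Set (Eucl n)) : ℝ≥0∞ :=
  ∫⁻ x in S, ENNReal.ofReal (ω x) ∂(nuA n α)

/-- The Bekollé–Bonami constant `[ω]_{p,α}` (with `p' = p/(p-1)`). -/
def BB (n : ℕ) (p α : ℝ) (ω : Eucl n → ℝ) : ℝ≥0∞ :=
  ⨆ (x : Eucl n) (_ : ‖x‖ = 1) (r : ℝ) (_ : 0 < r) (_ : r < 1),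
    (wInt α ω (cBoxBall x r) / nuA n α (cBoxBall x r)) *
      (wInt α (fun y => ω y ^ (1 - p / (p - 1))) (cBoxBall x r) /
        nuA n α (cBoxBall x r)) ^ (p - 1)

/-- The maximal operator `M_α` over Carleson boxes of spherical balls. -/
def maxOp (n : ℕ) (α : ℝ) (f : Eucl n → ℝ) (x : Eucl n) : ℝ≥0∞ :=
  ⨆ (ξ : Eucl n) (_ : ‖ξ‖ = 1) (r : ℝ) (_ : 0 < r) (_ : r < 1),
    (cBoxBall ξ r).indicator
      (fun _ => (∫⁻ y in cBoxBall ξ r, ENNReal.ofReal |f y| ∂(nuA n α)) /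
        nuA n α (cBoxBall ξ r)) x

/-- The `L^q(ω dν_α)` "norm" of an `ℝ≥0∞`-valued function. -/
def pnormW (n : ℕ) (α q : ℝ) (ω : Eucl n → ℝ) (F : Eucl n → ℝ≥0∞) : ℝ≥0∞ :=
  (∫⁻ x, F x ^ q * ENNReal.ofReal (ω x) ∂(nuA n α)) ^ (1 / q)

/-- The part of the cone over `S` lying in the shell `1 - h < ‖z‖ < 1`. -/
def sectorShell {n : ℕ} (S : Set (Eucl n)) (h : ℝ) : Set (Eucl n) :=
  {z | ‖z‖ < 1 ∧ 1 - h < ‖z‖ ∧ ‖z‖⁻¹ • z ∈ S}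

/-- The radial factor of `muA n α (sectorShell S h)` in polar coordinates. -/
def radialMass (n : ℕ) (α h : ℝ) : ℝ≥0∞ :=
  ∫⁻ t in Set.Ioo (1 - h) 1 ∩ Set.Ioi 0,
    ENNReal.ofReal (t ^ (n - 1)) * ENNReal.ofReal ((1 - t ^ 2) ^ α)

lemma measurableSet_sectorShell {n : ℕ} {S : Set (Eucl n)} (hS : MeasurableSet S) (h : ℝ) :
    MeasurableSet (sectorShell S h) := by
  have h1 : Measurable fun z : Eucl n => ‖z‖⁻¹ • z := by fun_prop
  exact (measurableSet_lt measurable_norm measurable_const).inter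
    ((measurableSet_lt measurable_const measurable_norm).inter (h1 hS))

lemma sectorShell_mono {n : ℕ} {S T : Set (Eucl n)} {h k : ℝ} (hST : S ⊆ T) (hk : h ≤ k) :
    sectorShell S h ⊆ sectorShell T k :=
  fun _ hz => ⟨hz.1, by linarith [hz.2.1], hST hz.2.2⟩

lemma muA_sectorShell {n : ℕ} (hn : 1 ≤ n) (α h : ℝ) {S : Set (Eucl n)}
    (hS : MeasurableSet S) :
    muA n α (sectorShell S h) =
      (volume : Measure (Eucl n)).toSphere (Subtype.val ⁻¹' S) * radialMass n α h := by
  have : Nonempty (Fin n) := ⟨⟨0, hn⟩⟩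
  have hm := measurableSet_sectorShell hS h
  set w : ℝ → ℝ≥0∞ := fun t => ENNReal.ofReal ((1 - t ^ 2) ^ α) with hw
  have hwm : Measurable w := by fun_prop
  set F : Eucl n → ℝ≥0∞ := fun z =>
    S.indicator 1 (‖z‖⁻¹ • z) * (Set.Ioo (1 - h) 1).indicator w ‖z‖ with hF
  have h1 : muA n α (sectorShell S h) = ∫⁻ z, F z := by
    rw [muA, withDensity_apply _ hm, Measure.restrict_restrict hm,
      Set.inter_eq_left.2 (fun z hz => by simpa using hz.1), ← lintegral_indicator hm]
    congr 1
    ext z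
    by_cases h1 : ‖z‖ < 1 <;> by_cases h2 : 1 - h < ‖z‖ <;> by_cases h3 : ‖z‖⁻¹ • z ∈ S <;>
      simp [hF, sectorShell, Set.indicator, h1, h2, h3, hw]
  have h2 : ∫⁻ z, F z = ∫⁻ z : ({(0)}ᶜ : Set (Eucl n)), F z ∂(volume.comap Subtype.val) := by
    rw [lintegral_subtype_comap (measurableSet_singleton _).compl F, restrict_compl_singleton]
  have h3 : ∫⁻ z : ({(0)}ᶜ : Set (Eucl n)), F z ∂(volume.comap Subtype.val) =
      ∫⁻ q, S.indicator 1 (q.1 : Eucl n) *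
        (Set.Ioo (1 - h) 1).indicator w (q.2 : ℝ)
        ∂((volume : Measure (Eucl n)).toSphere.prod
          (.volumeIoiPow (Module.finrank ℝ (Eucl n) - 1))) := by
    rw [← (volume : Measure (Eucl n)).measurePreserving_homeomorphUnitSphereProd.lintegral_comp_emb
      (Homeomorph.measurableEmbedding _)]
    refine lintegral_congr fun z => ?_
    simp [hF]
  have hSm : MeasurableSet (Subtype.val ⁻¹' S : Set (sphere (0 : Eucl n) 1)) :=
    measurable_subtype_coe hS
  have hgm : Measurable fun t : Set.Ioi (0 : ℝ) => (Set.Ioo (1 - h) 1).indicator w (t : ℝ) :=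
    (hwm.indicator measurableSet_Ioo).comp measurable_subtype_coe
  have hSi : ∫⁻ y : sphere (0 : Eucl n) 1, S.indicator 1 (y : Eucl n)
      ∂(volume : Measure (Eucl n)).toSphere =
        (volume : Measure (Eucl n)).toSphere (Subtype.val ⁻¹' S) :=
    lintegral_indicator_one hSm
  have hfm : Measurable fun y : sphere (0 : Eucl n) 1 =>
      (S.indicator 1 (y : Eucl n) : ℝ≥0∞) :=
    (measurable_one.indicator hS).comp measurable_subtype_coe
  rw [h1, h2, h3, lintegral_prod_mul (f := fun y : sphere (0 : Eucl n) 1 =>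
      (S.indicator 1 (y : Eucl n) : ℝ≥0∞)) hfm.aemeasurable hgm.aemeasurable, hSi]
  congr 1
  rw [Measure.volumeIoiPow, lintegral_withDensity_eq_lintegral_mul _ (by fun_prop) hgm]
  simp only [Pi.mul_apply, finrank_euclideanSpace, Fintype.card_fin]
  rw [lintegral_subtype_comap measurableSet_Ioi
    (fun t : ℝ => ENNReal.ofReal (t ^ (n - 1)) * (Set.Ioo (1 - h) 1).indicator w t), radialMass,
    ← Measure.restrict_restrict measurableSet_Ioo, ← lintegral_indicator measurableSet_Ioo]
  congr 1
  ext t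
  simp [Set.indicator, hw]

lemma lintegral_one_sub_rpow {α h : ℝ} (hα : -1 < α) (hh : 0 < h) :
    ∫⁻ t in Set.Ioo (1 - h) 1, ENNReal.ofReal ((1 - t) ^ α) =
      ENNReal.ofReal (h ^ (α + 1) / (α + 1)) := by
  have hi : IntervalIntegrable (fun t : ℝ => (1 - t) ^ α) volume (1 - h) 1 := by
    have := (intervalIntegral.intervalIntegrable_rpow' (a := 0) (b := h) hα).comp_sub_left 1
    simpa using this.symm
  rw [restrict_Ioo_eq_restrict_Ioc,
    ← ofReal_integral_eq_lintegral_ofReal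
      ((intervalIntegrable_iff_integrableOn_Ioc_of_le (by linarith)).1 hi),
    ← intervalIntegral.integral_of_le (by linarith)]
  · rw [intervalIntegral.integral_comp_sub_left (fun t => t ^ α), integral_rpow (Or.inl hα)]
    simp [Real.zero_rpow (by linarith : α + 1 ≠ 0)]
  · filter_upwards [ae_restrict_mem measurableSet_Ioc] with t ht
    exact Real.rpow_nonneg (by linarith [ht.2]) _

lemma rpow_mem_Icc_of_mem_Icc_one_two (α : ℝ) {s : ℝ} (h1 : 1 ≤ s) (h2 : s ≤ 2) :
    (2 : ℝ) ^ (-|α|) ≤ s ^ α ∧ s ^ α ≤ 2 ^ |α| := by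
  have hs : 0 < s := by linarith
  constructor
  · calc (2 : ℝ) ^ (-|α|) = (2 ^ |α|)⁻¹ := Real.rpow_neg (by norm_num) _
      _ ≤ (s ^ |α|)⁻¹ := by gcongr
      _ = s ^ (-|α|) := (Real.rpow_neg hs.le _).symm
      _ ≤ s ^ α := Real.rpow_le_rpow_of_exponent_le h1 (neg_abs_le α)
  · calc s ^ α ≤ s ^ |α| := Real.rpow_le_rpow_of_exponent_le h1 (le_abs_self α)
      _ ≤ 2 ^ |α| := by gcongr

lemma radialMass_le (n : ℕ) {α h : ℝ} (hα : -1 < α) (hh : 0 < h) :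
    radialMass n α h ≤ ENNReal.ofReal (2 ^ |α| * (h ^ (α + 1) / (α + 1))) := by
  rw [ENNReal.ofReal_mul (by positivity), ← lintegral_one_sub_rpow hα hh,
    ← lintegral_const_mul _ (by fun_prop)]
  refine le_trans (setLIntegral_mono' (measurableSet_Ioo.inter measurableSet_Ioi) ?_)
    (lintegral_mono_set Set.inter_subset_left)
  rintro t ⟨⟨-, h1⟩, h0 : 0 < t⟩
  rw [← ENNReal.ofReal_mul (by positivity), ← ENNReal.ofReal_mul (by positivity)]
  refine ENNReal.ofReal_le_ofReal ?_
  have e : (1 - t ^ 2) ^ α = (1 + t) ^ α * (1 - t) ^ α := by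
    rw [← Real.mul_rpow (by linarith) (by linarith)]; ring_nf
  have hp : 0 ≤ (1 - t) ^ α := Real.rpow_nonneg (by linarith) _
  have hq : 0 ≤ (1 + t) ^ α := Real.rpow_nonneg (by linarith) _
  rw [e]
  calc t ^ (n - 1) * ((1 + t) ^ α * (1 - t) ^ α) ≤ 1 * ((1 + t) ^ α * (1 - t) ^ α) := by
        gcongr
        exact pow_le_one₀ h0.le h1.le
    _ ≤ 2 ^ |α| * (1 - t) ^ α := by
        rw [one_mul]
        gcongr
        exact (rpow_mem_Icc_of_mem_Icc_one_two α (by linarith) (by linarith)).2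

lemma le_radialMass (n : ℕ) {α h : ℝ} (hα : -1 < α) (hh : 0 < h) (hh1 : h ≤ 1) :
    ENNReal.ofReal ((1 / 2) ^ (n - 1) * 2 ^ (-|α|) * ((h / 2) ^ (α + 1) / (α + 1))) ≤
      radialMass n α h := by
  rw [ENNReal.ofReal_mul (by positivity), ← lintegral_one_sub_rpow hα (by linarith),
    ← lintegral_const_mul _ (by fun_prop)]
  refine le_trans (setLIntegral_mono' measurableSet_Ioo ?_) (lintegral_mono_set
    (show Set.Ioo (1 - h / 2) 1 ⊆ Set.Ioo (1 - h) 1 ∩ Set.Ioi 0 from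
      fun t ht => ⟨⟨by linarith [ht.1], ht.2⟩, show 0 < t by linarith [ht.1]⟩))
  rintro t ⟨h0, h1⟩
  have ht : 1 / 2 ≤ t := by linarith
  rw [← ENNReal.ofReal_mul (by positivity), ← ENNReal.ofReal_mul (by positivity)]
  refine ENNReal.ofReal_le_ofReal ?_
  have e : (1 - t ^ 2) ^ α = (1 + t) ^ α * (1 - t) ^ α := by
    rw [← Real.mul_rpow (by linarith) (by linarith)]; ring_nf
  have hp : 0 ≤ (1 - t) ^ α := Real.rpow_nonneg (by linarith) _
  rw [e, mul_assoc]
  gcongr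
  exact (rpow_mem_Icc_of_mem_Icc_one_two α (by linarith) (by linarith)).1

lemma radialMass_ne_zero (n : ℕ) {α h : ℝ} (hα : -1 < α) (hh : 0 < h) (hh1 : h ≤ 1) :
    radialMass n α h ≠ 0 := by
  refine ((ENNReal.ofReal_pos.2 ?_).trans_le (le_radialMass n hα hh hh1)).ne'
  have : 0 < α + 1 := by linarith
  positivity

lemma radialMass_ne_top (n : ℕ) {α h : ℝ} (hα : -1 < α) (hh : 0 < h) :
    radialMass n α h ≠ ⊤ :=
  ne_top_of_le_ne_top ENNReal.ofReal_ne_top (radialMass_le n hα hh)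

lemma exists_radialMass_mul_le (n : ℕ) {α C : ℝ} (hα : -1 < α) (hC : 0 < C) :
    ∃ K : ℝ, 0 < K ∧ ∀ h : ℝ, 0 < h → h ≤ 1 →
      radialMass n α (C * h) ≤ ENNReal.ofReal K * radialMass n α h := by
  have hα1 : 0 < α + 1 := by linarith
  set a : ℝ := 2 ^ |α| with ha
  set b : ℝ := (1 / 2) ^ (n - 1) * 2 ^ (-|α|) with hb
  have ha0 : 0 < a := by positivity
  have hb0 : 0 < b := by positivity
  refine ⟨a / b * (2 * C) ^ (α + 1), by positivity, fun h hh hh1 => ?_⟩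
  refine (radialMass_le n hα (by positivity)).trans
    (le_trans (le_of_eq ?_) (mul_le_mul_right (le_radialMass n hα hh hh1) _))
  rw [← ENNReal.ofReal_mul (by positivity), ← ha, ← hb]
  congr 1
  rw [show C * h = (2 * C) * (h / 2) by ring, Real.mul_rpow (by positivity) (by positivity)]
  field_simp

/-- The closed spherical ball of radius `R`. -/
def closedCap {n : ℕ} (x : Eucl n) (R : ℝ) : Set (Eucl n) := {y | ‖y‖ = 1 ∧ rho x y ≤ R}

lemma measurable_rho {n : ℕ} (x : Eucl n) : Measurable (rho x) :=
  (Real.continuous_arccos.comp (by fun_prop)).measurable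

lemma measurableSet_sBall {n : ℕ} (x : Eucl n) (r : ℝ) : MeasurableSet (sBall x r) :=
  (measurableSet_eq_fun measurable_norm measurable_const).inter
    (measurableSet_lt (measurable_rho x) measurable_const)

lemma measurableSet_closedCap {n : ℕ} (x : Eucl n) (R : ℝ) : MeasurableSet (closedCap x R) :=
  (measurableSet_eq_fun measurable_norm measurable_const).inter
    (measurableSet_le (measurable_rho x) measurable_const)

lemma rho_eq_angle {n : ℕ} {x y : Eucl n} (hx : ‖x‖ = 1) (hy : ‖y‖ = 1) :
    rho x y = InnerProductGeometry.angle x y := by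
  simp [rho, InnerProductGeometry.angle, hx, hy]

lemma norm_sub_sq_eq_cos_rho {n : ℕ} {x y : Eucl n} (hx : ‖x‖ = 1) (hy : ‖y‖ = 1) :
    ‖y - x‖ ^ 2 = 2 - 2 * Real.cos (rho x y) := by
  rw [rho_eq_angle hx hy]
  have h := InnerProductGeometry.cos_angle_mul_norm_mul_norm x y
  rw [hx, hy] at h
  rw [norm_sub_sq_real, hx, hy, real_inner_comm]
  linarith

lemma norm_sub_le_rho {n : ℕ} {x y : Eucl n} (hx : ‖x‖ = 1) (hy : ‖y‖ = 1) :
    ‖y - x‖ ≤ rho x y := by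
  refine le_of_sq_le_sq ?_ (Real.arccos_nonneg _)
  rw [norm_sub_sq_eq_cos_rho hx hy]
  linarith [Real.one_sub_sq_div_two_le_cos (x := rho x y)]

lemma rho_le_two_mul_norm_sub {n : ℕ} {x y : Eucl n} (hx : ‖x‖ = 1) (hy : ‖y‖ = 1) :
    rho x y ≤ 2 * ‖y - x‖ := by
  have h0 : 0 ≤ rho x y := Real.arccos_nonneg _
  have hpi : rho x y ≤ Real.pi := Real.arccos_le_pi _
  refine le_of_sq_le_sq ?_ (by positivity)
  have h := Real.cos_le_one_sub_mul_cos_sq (x := rho x y) (by rwa [abs_of_nonneg h0])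
  rw [mul_pow, norm_sub_sq_eq_cos_rho hx hy]
  have h2 : (1 : ℝ) / 8 ≤ 2 / Real.pi ^ 2 := by
    rw [div_le_div_iff₀ (by norm_num) (by positivity)]
    nlinarith [Real.pi_le_four, Real.pi_pos]
  nlinarith [mul_le_mul_of_nonneg_right h2 (sq_nonneg (rho x y))]

lemma norm_inv_norm_smul_sub {n : ℕ} {z : Eucl n} (hz : z ≠ 0) (h1 : ‖z‖ ≤ 1) :
    ‖‖z‖⁻¹ • z - z‖ = 1 - ‖z‖ := by
  have h0 : 0 < ‖z‖ := norm_pos_iff.2 hz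
  have : ‖z‖⁻¹ • z - z = (‖z‖⁻¹ - 1) • z := by rw [sub_smul, one_smul]
  rw [this, norm_smul, Real.norm_of_nonneg (sub_nonneg.2 ((one_le_inv₀ h0).2 h1))]
  field_simp

lemma rho_le_add_rho {n : ℕ} {x y z : Eucl n} (hx : ‖x‖ = 1) (hy : ‖y‖ = 1) (hz : ‖z‖ = 1) :
    rho y z ≤ rho x y + rho x z := by
  rw [rho_eq_angle hx hy, rho_eq_angle hx hz, rho_eq_angle hy hz,
    InnerProductGeometry.angle_comm x y]
  exact InnerProductGeometry.angle_le_angle_add_angle _ _ _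

lemma bddAbove_rho {n : ℕ} (Q : Set (Eucl n)) :
    BddAbove {d | ∃ x ∈ Q, ∃ y ∈ Q, d = rho x y} :=
  ⟨Real.pi, by rintro d ⟨x, -, y, -, rfl⟩; exact Real.arccos_le_pi _⟩

lemma rho_le_diamRho {n : ℕ} {Q : Set (Eucl n)} {x y : Eucl n} (hx : x ∈ Q) (hy : y ∈ Q) :
    rho x y ≤ diamRho Q :=
  le_csSup (bddAbove_rho Q) ⟨x, hx, y, hy, rfl⟩

lemma mem_sBall_self {n : ℕ} {x : Eucl n} {r : ℝ} (hx : ‖x‖ = 1) (hr : 0 < r) :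
    x ∈ sBall x r :=
  ⟨hx, by simpa [rho, hx] using hr⟩

lemma diamRho_sBall_le {n : ℕ} {x : Eucl n} {r : ℝ} (hx : ‖x‖ = 1) (hr : 0 < r) :
    diamRho (sBall x r) ≤ 2 * r := by
  refine csSup_le ⟨_, x, mem_sBall_self hx hr, x, mem_sBall_self hx hr, rfl⟩ ?_
  rintro d ⟨y, hy, z, hz, rfl⟩
  linarith [rho_le_add_rho hx hy.1 hz.1, hy.2, hz.2]

lemma exists_norm_eq_one_inner_eq_zero {n : ℕ} (hn : 2 ≤ n) (x : Eucl n) :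
    ∃ e : Eucl n, ‖e‖ = 1 ∧ ⟪x, e⟫ = 0 := by
  have h1 := (ℝ ∙ x).finrank_add_finrank_orthogonal
  have h2 : Module.finrank ℝ (ℝ ∙ x) ≤ 1 := by simpa using finrank_span_le_card (R := ℝ) {x}
  rw [finrank_euclideanSpace, Fintype.card_fin] at h1
  have : Nontrivial (ℝ ∙ x)ᗮ := Module.nontrivial_of_finrank_pos (R := ℝ) (by omega)
  obtain ⟨e, he⟩ := exists_norm_eq (ℝ ∙ x)ᗮ (zero_le_one (α := ℝ))
  exact ⟨e, he, Submodule.mem_orthogonal_singleton_iff_inner_right.1 e.2⟩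

lemma two_mul_le_diamRho {n : ℕ} (hn : 2 ≤ n) {x : Eucl n} {r : ℝ} (hx : ‖x‖ = 1)
    (hr : 0 < r) (hr1 : r < 1) {Q : Set (Eucl n)} (hQ : sBall x r ⊆ Q) :
    2 * r ≤ diamRho Q := by
  obtain ⟨e, he, hxe⟩ := exists_norm_eq_one_inner_eq_zero hn x
  have hxx : ⟪x, x⟫ = 1 := by rw [real_inner_self_eq_norm_sq, hx, one_pow]
  have hee : ⟪e, e⟫ = 1 := by rw [real_inner_self_eq_norm_sq, he, one_pow]
  have hex : ⟪e, x⟫ = 0 := by rw [real_inner_comm, hxe]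
  have hpi := Real.pi_gt_three
  have key : ∀ s t : ℝ, ⟪Real.cos s • x + Real.sin s • e, Real.cos t • x + Real.sin t • e⟫ =
      Real.cos (s - t) := by
    intro s t
    simp only [inner_add_left, inner_add_right, real_inner_smul_left, real_inner_smul_right,
      hxx, hee, hxe, hex, Real.cos_sub]
    ring
  have hmem : ∀ s : ℝ, |s| < r → Real.cos s • x + Real.sin s • e ∈ sBall x r := by
    intro s hs
    constructor
    · have := key s s
      rw [real_inner_self_eq_norm_sq, sub_self, Real.cos_zero] at this
      exact (pow_eq_one_iff_of_nonneg (norm_nonneg _) two_ne_zero).1 this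
    · have := key 0 s
      rw [Real.cos_zero, Real.sin_zero, one_smul, zero_smul, add_zero, zero_sub,
        Real.cos_neg] at this
      rw [rho, this, ← Real.cos_abs, Real.arccos_cos (abs_nonneg s) (by linarith)]
      exact hs
  refine le_of_forall_lt_imp_le_of_dense fun d hd => ?_
  rcases le_or_gt d 0 with h0 | h0
  · exact h0.trans ((Real.arccos_nonneg _).trans
      (rho_le_diamRho (hQ (mem_sBall_self hx hr)) (hQ (mem_sBall_self hx hr))))
  · have h1 := rho_le_diamRho (hQ (hmem (d / 2) (by rw [abs_of_pos (by linarith)]; linarith)))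
      (hQ (hmem (-(d / 2)) (by rw [abs_neg, abs_of_pos (by linarith)]; linarith)))
    rw [rho, key, show d / 2 - -(d / 2) = d by ring,
      Real.arccos_cos h0.le (by linarith)] at h1
    exact h1

lemma ball_subset_sectorShell_sBall {n : ℕ} {x : Eucl n} {r : ℝ} (hx : ‖x‖ = 1)
    (hr : 0 < r) (hr1 : r < 1) :
    ball ((1 - r / 8) • x) (r / 8) ⊆ sectorShell (sBall x r) r := by
  intro z hz
  rw [mem_ball, dist_eq_norm] at hz
  have hc : ‖(1 - r / 8) • x‖ = 1 - r / 8 := by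
    rw [norm_smul, hx, mul_one, Real.norm_of_nonneg (by linarith)]
  have h1 : ‖z‖ < 1 := by
    have := norm_le_norm_add_norm_sub' z ((1 - r / 8) • x)
    linarith
  have h2 : 1 - r / 4 < ‖z‖ := by
    have := norm_le_norm_add_norm_sub z ((1 - r / 8) • x)
    linarith
  have hz0 : z ≠ 0 := by
    rintro rfl
    rw [norm_zero] at h2
    linarith
  have hu : ‖‖z‖⁻¹ • z‖ = 1 := norm_smul_inv_norm (𝕜 := ℝ) hz0
  refine ⟨h1, by linarith, hu, ?_⟩
  have h3 : ‖z - x‖ < r / 4 := by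
    have h4 : ‖(1 - r / 8) • x - x‖ = r / 8 := by
      rw [show (1 - r / 8) • x - x = (-(r / 8)) • x by module, norm_smul, hx, mul_one, norm_neg,
        Real.norm_of_nonneg (by linarith)]
    have := norm_sub_le_norm_sub_add_norm_sub z ((1 - r / 8) • x) x
    linarith
  have h5 := norm_inv_norm_smul_sub hz0 h1.le
  have h6 := norm_sub_le_norm_sub_add_norm_sub (‖z‖⁻¹ • z) z x
  linarith [rho_le_two_mul_norm_sub hx hu]

lemma sectorShell_closedCap_subset {n : ℕ} {x : Eucl n} {r R : ℝ} (hx : ‖x‖ = 1) :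
    sectorShell (closedCap x R) r ⊆ closedBall x (r + R) := by
  rintro z ⟨h1, h2, hu, h3⟩
  have hz0 : z ≠ 0 := by
    rintro rfl
    simp at hu
  rw [mem_closedBall, dist_eq_norm]
  have h5 := norm_inv_norm_smul_sub hz0 h1.le
  have h6 := norm_sub_le_norm_sub_add_norm_sub z (‖z‖⁻¹ • z) x
  rw [norm_sub_rev] at h5
  linarith [norm_sub_le_rho hx hu]

lemma exists_toSphere_closedCap_le {n : ℕ} (hn : 1 ≤ n) {C : ℝ} (hC : 0 < C) :
    ∃ K : ℝ, 0 < K ∧ ∀ (x : Eucl n) (r : ℝ), ‖x‖ = 1 → 0 < r → r < 1 →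
      (volume : Measure (Eucl n)).toSphere (Subtype.val ⁻¹' closedCap x (C * r)) ≤
        ENNReal.ofReal K * (volume : Measure (Eucl n)).toSphere (Subtype.val ⁻¹' sBall x r) := by
  have : Nonempty (Fin n) := ⟨⟨0, hn⟩⟩
  refine ⟨(8 * (1 + C)) ^ n, by positivity, fun x r hx hr hr1 => ?_⟩
  have h0 : (-1 : ℝ) < 0 := by norm_num
  have hvol : ∀ S : Set (Eucl n), MeasurableSet S →
      volume (sectorShell S r) =
        (volume : Measure (Eucl n)).toSphere (Subtype.val ⁻¹' S) * radialMass n 0 r := by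
    intro S hS
    have hm := measurableSet_sectorShell hS r
    rw [← muA_sectorShell hn 0 r hS]
    simp only [muA, Real.rpow_zero, ENNReal.ofReal_one]
    rw [show (fun _ : Eucl n => (1 : ℝ≥0∞)) = 1 from rfl, withDensity_one,
      Measure.restrict_apply hm, Set.inter_eq_left.2 (fun z hz => by simpa using hz.1)]
  rw [← ENNReal.mul_le_mul_iff_left (radialMass_ne_zero n h0 hr hr1.le)
    (radialMass_ne_top n h0 hr), mul_assoc, ← hvol _ (measurableSet_closedCap x _),
    ← hvol _ (measurableSet_sBall x r)]
  calc volume (sectorShell (closedCap x (C * r)) r)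
      ≤ volume (closedBall x (r + C * r)) := measure_mono (sectorShell_closedCap_subset hx)
    _ = ENNReal.ofReal ((8 * (1 + C)) ^ n) * volume (ball ((1 - r / 8) • x) (r / 8)) := by
        rw [Measure.addHaar_closedBall _ _ (by positivity),
          Measure.addHaar_ball _ ((1 - r / 8) • x) (by positivity), finrank_euclideanSpace, Fintype.card_fin,
          ← mul_assoc, ← ENNReal.ofReal_mul (by positivity), ← mul_pow]
        congr 3
        field_simp
    _ ≤ ENNReal.ofReal ((8 * (1 + C)) ^ n) * volume (sectorShell (sBall x r) r) := by
        gcongr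
        exact ball_subset_sectorShell_sBall hx hr hr1

lemma exists_nuA_sectorShell_closedCap_le {n : ℕ} (hn : 1 ≤ n) {α C D : ℝ} (hα : -1 < α)
    (hC : 0 < C) (hD : 0 < D) :
    ∃ K : ℝ, 0 < K ∧ ∀ (x : Eucl n) (r : ℝ), ‖x‖ = 1 → 0 < r → r < 1 →
      nuA n α (sectorShell (closedCap x (C * r)) (D * r)) ≤
        ENNReal.ofReal K * nuA n α (sectorShell (sBall x r) r) := by
  obtain ⟨K₁, hK₁, h₁⟩ := exists_toSphere_closedCap_le hn hC
  obtain ⟨K₂, hK₂, h₂⟩ := exists_radialMass_mul_le n hα hD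
  refine ⟨K₁ * K₂, by positivity, fun x r hx hr hr1 => ?_⟩
  simp only [nuA, Measure.smul_apply, smul_eq_mul]
  rw [mul_left_comm]
  gcongr
  rw [muA_sectorShell hn α _ (measurableSet_closedCap x _),
    muA_sectorShell hn α _ (measurableSet_sBall x r), ENNReal.ofReal_mul hK₁.le,
    mul_mul_mul_comm]
  exact mul_le_mul' (h₁ x r hx hr hr1) (h₂ r hr hr1.le)

lemma div_mul_div_rpow_le {a b A B m M : ℝ≥0∞} {K p : ℝ} (hp : 1 ≤ p) (hK : 0 < K)
    (ha : a ≤ A) (hb : b ≤ B) (hm : M ≤ ENNReal.ofReal K * m) :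
    a / m * (b / m) ^ (p - 1) ≤ ENNReal.ofReal (K ^ p) * (A * B ^ (p - 1) / M ^ p) := by
  have hK0 : ENNReal.ofReal K ≠ 0 := (ENNReal.ofReal_pos.2 hK).ne'
  have hinv : m⁻¹ ≤ ENNReal.ofReal K * M⁻¹ := by
    calc m⁻¹ = ENNReal.ofReal K * (ENNReal.ofReal K * m)⁻¹ := by
          rw [ENNReal.mul_inv (Or.inl hK0) (Or.inl ENNReal.ofReal_ne_top), ← mul_assoc,
            ENNReal.mul_inv_cancel hK0 ENNReal.ofReal_ne_top, one_mul]
      _ ≤ ENNReal.ofReal K * M⁻¹ := by gcongr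
  have hp1 : 0 ≤ p - 1 := by linarith
  have e : m⁻¹ * m⁻¹ ^ (p - 1) = m⁻¹ ^ p := by
    have h := ENNReal.rpow_add_of_nonneg (x := m⁻¹) 1 (p - 1) zero_le_one hp1
    rw [ENNReal.rpow_one, add_sub_cancel] at h
    exact h.symm
  calc a / m * (b / m) ^ (p - 1) = a * b ^ (p - 1) * m⁻¹ ^ p := by
        rw [div_eq_mul_inv, div_eq_mul_inv, ENNReal.mul_rpow_of_nonneg _ _ hp1, ← e]
        ring
    _ ≤ A * B ^ (p - 1) * (ENNReal.ofReal K * M⁻¹) ^ p := by gcongr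
    _ = ENNReal.ofReal (K ^ p) * (A * B ^ (p - 1) / M ^ p) := by
        rw [ENNReal.mul_rpow_of_nonneg _ _ (by linarith), div_eq_mul_inv, ENNReal.inv_rpow,
          ENNReal.ofReal_rpow_of_pos hK]
        ring

/-- if every spherical ball is contained in some `Q ∈ 𝒟` of comparable
diameter, then `[ω]_{p,α} ≤ c₅·sup_{Q∈𝒟} |Q̂|_{ω,α}(|Q̂|_{ω^{1−p'},α})^{p−1}/(|Q̂|_α)^p`,
with `c₅` depending only on `n, p, α, C₃`. -/
theorem stmt9 (n : ℕ) (hn : 3 ≤ n) (p α C₃ : ℝ) (hp : 1 < p) (hα : -1 < α)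
    (hC₃ : 1 ≤ C₃) :
    ∃ c₅ : ℝ, 0 < c₅ ∧
      ∀ 𝒟 : Set (Set (Eucl n)),
        (∀ Q ∈ 𝒟, Q.Nonempty ∧ MeasurableSet Q ∧ ∀ y ∈ Q, ‖y‖ = 1) →
        (∀ (x : Eucl n) (r : ℝ), ‖x‖ = 1 → 0 < r → r < 1 →
          ∃ Q ∈ 𝒟, sBall x r ⊆ Q ∧ diamRho Q ≤ C₃ * diamRho (sBall x r)) →
        ∀ ω : Eucl n → ℝ, (∀ z, 0 ≤ ω z) → Integrable ω (nuA n α) →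
          BB n p α ω ≤
            ENNReal.ofReal c₅ *
              ⨆ Q ∈ 𝒟,
                wInt α ω (cBox Q) *
                    (wInt α (fun y => ω y ^ (1 - p / (p - 1))) (cBox Q)) ^ (p - 1) /
                    nuA n α (cBox Q) ^ p := by

  have hn1 : 1 ≤ n := by omega
  have hC₃0 : 0 < C₃ := by linarith
  obtain ⟨K, hK, hKle⟩ := exists_nuA_sectorShell_closedCap_le hn1 hα
    (mul_pos two_pos hC₃0) hC₃0
  refine ⟨K ^ p, by positivity, fun 𝒟 h𝒟 hcover ω _ _ => ?_⟩
  refine iSup₂_le fun x hx => iSup₂_le fun r hr => iSup_le fun hr1 => ?_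
  obtain ⟨Q, hQ, hsub, hdiam⟩ := hcover x r hx hr hr1
  have hd : diamRho Q ≤ 2 * C₃ * r := by
    have := mul_le_mul_of_nonneg_left (diamRho_sBall_le hx hr) hC₃0.le
    linarith
  have hlow := two_mul_le_diamRho (by omega) hx hr hr1 hsub
  have hbox : cBoxBall x r ⊆ cBox Q := sectorShell_mono hsub (by linarith)
  have hcap : Q ⊆ closedCap x (2 * C₃ * r) := fun y hy =>
    ⟨(h𝒟 Q hQ).2.2 y hy, (rho_le_diamRho (hsub (mem_sBall_self hx hr)) hy).trans hd⟩
  have hmeas : nuA n α (cBox Q) ≤ ENNReal.ofReal K * nuA n α (cBoxBall x r) :=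
    (measure_mono (sectorShell_mono hcap (by linarith))).trans (hKle x r hx hr hr1)
  refine (div_mul_div_rpow_le hp.le hK (lintegral_mono_set hbox) (lintegral_mono_set hbox)
    hmeas).trans ?_
  gcongr
  exact le_iSup₂_of_le Q hQ le_rfl
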